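/- arXiv:1710.07854 — 5 statements merged into one kernel-verified Lean document; each statement's English description precedes it below -/
import Mathlib

section
/- Suppose λ is a family of nonempty C_ι-compact subsets of X that is hereditary with respect to C_ι-compact subsets (whenever A ∈ λ and B is a nonempty C_ι-compact subset of X with B ⊆ A, then B ∈ λ), closed under finite unions, and satisfies λ = λ(C_ι). Then λ_m := {A ⊆ X : A nonempty and [A,U] ∈ τ_λ for every open U ⊆ ℝ^ι} equals the family {B ⊆ X : B nonempty, B is C_ι-compact in X, and B ⊆ closure(A) for some A ∈ λ}. -/
open Topology Set

/-- The λ-open (set-open) topology on `C(X, ι → ℝ)` generated by the subbasis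
`[A, U] = {f | f(A) ⊆ U}` for `A ∈ Λ` and `U` open in `ι → ℝ`. -/
def setOpenTopology {X : Type*} [TopologicalSpace X] (ι : Type*) (Λ : Set (Set X)) :
    TopologicalSpace C(X, ι → ℝ) :=
  TopologicalSpace.generateFrom
    {S | ∃ A ∈ Λ, ∃ U : Set (ι → ℝ), IsOpen U ∧ S = {f : C(X, ι → ℝ) | Set.MapsTo f A U}}

/-- A subset `B ⊆ X` is `C_ι`-compact in `X` if `f(B)` is compact in `ℝ^ι`
for every continuous `f : X → ℝ^ι`. -/
def CCompactIn {X : Type*} [TopologicalSpace X] (ι : Type*) (B : Set X) : Prop :=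
  ∀ f : C(X, ι → ℝ), IsCompact (⇑f '' B)

/-- The family `λ(C_ι)`. -/
def lambdaC {X : Type*} [TopologicalSpace X] (ι : Type*) (Λ : Set (Set X)) : Set (Set X) :=
  {A | A ∈ Λ ∧ ∀ B ⊆ A, CCompactIn ι B → ∀ U : Set (ι → ℝ), IsOpen U →
    IsOpen[setOpenTopology ι Λ] {f : C(X, ι → ℝ) | Set.MapsTo f B U}}

/-- The maximal family `λ_m`: all nonempty `A ⊆ X` such that `[A,U]` is `τ_λ`-open for
every open `U ⊆ ℝ^ι`. -/
def lambdaM {X : Type*} [TopologicalSpace X] (ι : Type*) (Λ : Set (Set X)) : Set (Set X) :=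
  {A | A.Nonempty ∧ ∀ U : Set (ι → ℝ), IsOpen U →
    IsOpen[setOpenTopology ι Λ] {f : C(X, ι → ℝ) | Set.MapsTo f A U}}

theorem CCompactIn.isCompact_image_prodMk {X ι : Type*} [TopologicalSpace X] [Nonempty ι]
    {B : Set X} (hB : CCompactIn ι B) (f g : C(X, ι → ℝ)) :
    IsCompact ((fun x => (f x, g x)) '' B) := by
  cases finite_or_infinite ι with
  | inl _ =>
    have := Fintype.ofFinite ι
    refine ((hB f).prod (hB g)).of_isClosed_subset ?_ ?_
    · refine isClosed_of_closure_subset fun p hp => ?_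
      have hφ : Continuous (fun q : (ι → ℝ) × (ι → ℝ) => fun _ : ι => dist q p) := by fun_prop
      have hK := (hB ⟨fun x _ => dist (f x, g x) p, by fun_prop⟩).isClosed
      have h0 := image_closure_subset_closure_image hφ (mem_image_of_mem _ hp)
      rw [image_image] at h0
      obtain ⟨x, hx, hxp⟩ := hK.closure_subset h0
      refine ⟨x, hx, ?_⟩
      have := congrFun hxp (Classical.arbitrary ι)
      simpa using this
    · rintro _ ⟨x, hx, rfl⟩
      exact ⟨mem_image_of_mem _ hx, mem_image_of_mem _ hx⟩
  | inr _ =>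
    obtain ⟨e⟩ : Nonempty (ι ≃ ι ⊕ ι) := by
      rw [← Cardinal.eq, Cardinal.mk_sum, Cardinal.lift_id,
        Cardinal.add_eq_self (Cardinal.aleph0_le_mk ι)]
    have h := hB ⟨fun x i => Sum.elim (f x) (g x) (e i), by
      refine continuous_pi fun i => ?_
      cases e i <;> simp only [Sum.elim_inl, Sum.elim_inr] <;> fun_prop⟩
    have hψ : Continuous (fun v : ι → ℝ =>
        ((fun i => v (e.symm (Sum.inl i)), fun i => v (e.symm (Sum.inr i))) :
          (ι → ℝ) × (ι → ℝ))) := by fun_prop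
    simpa [image_image] using h.image hψ

theorem CCompactIn.inter_preimage {X ι : Type*} [TopologicalSpace X] [Nonempty ι]
    {B : Set X} (hB : CCompactIn ι B) (f : C(X, ι → ℝ)) {K : Set (ι → ℝ)} (hK : IsClosed K) :
    CCompactIn ι (B ∩ f ⁻¹' K) := by
  intro g
  convert ((hB.isCompact_image_prodMk f g).inter_right
    (hK.preimage continuous_fst)).image continuous_snd using 1
  ext y
  constructor
  · rintro ⟨x, ⟨hx, hxK⟩, rfl⟩
    exact ⟨_, ⟨⟨x, hx, rfl⟩, hxK⟩, rfl⟩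
  · rintro ⟨_, ⟨⟨x, hx, rfl⟩, hxK⟩, rfl⟩
    exact ⟨x, ⟨hx, hxK⟩, rfl⟩

theorem CCompactIn.mapsTo_closure {X ι : Type*} [TopologicalSpace X] {A : Set X}
    (hA : CCompactIn ι A) {g : C(X, ι → ℝ)} {U : Set (ι → ℝ)} (hg : MapsTo g A U) :
    MapsTo g (closure A) U := fun _ hx =>
  hg.image_subset ((hA g).isClosed.closure_subset
    (image_closure_subset_closure_image g.continuous (mem_image_of_mem _ hx)))

/-- A neighbourhood of `f` in the `Λ`-open topology contains every function agreeing with `f`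
on a suitable set that is empty or in `Λ`. -/
theorem exists_forall_eqOn_mem {X ι : Type*} [TopologicalSpace X] {Λ : Set (Set X)}
    (hunion : ∀ A ∈ Λ, ∀ B ∈ Λ, A ∪ B ∈ Λ) {S : Set C(X, ι → ℝ)}
    (hS : IsOpen[setOpenTopology ι Λ] S) {f : C(X, ι → ℝ)} (hf : f ∈ S) :
    ∃ A, (A = ∅ ∨ A ∈ Λ) ∧ ∀ g : C(X, ι → ℝ), EqOn g f A → g ∈ S := by
  change TopologicalSpace.GenerateOpen _ S at hS
  induction hS with
  | basic S hS =>
    obtain ⟨A, hA, U, -, rfl⟩ := hS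
    exact ⟨A, Or.inr hA, fun g hg => MapsTo.congr hf hg.symm⟩
  | univ => exact ⟨∅, Or.inl rfl, fun _ _ => trivial⟩
  | inter S T _ _ ihS ihT =>
    obtain ⟨A, hA, hA'⟩ := ihS hf.1
    obtain ⟨B, hB, hB'⟩ := ihT hf.2
    refine ⟨A ∪ B, ?_, fun g hg => ⟨hA' g (hg.mono subset_union_left),
      hB' g (hg.mono subset_union_right)⟩⟩
    rcases hA with rfl | hA
    · simpa using hB
    · rcases hB with rfl | hB
      · simpa using Or.inr hA
      · exact Or.inr (hunion A hA B hB)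
  | sUnion 𝒮 _ ih =>
    obtain ⟨S, hS, hfS⟩ := hf
    obtain ⟨A, hA, hA'⟩ := ih S hS hfS
    exact ⟨A, hA, fun g hg => ⟨S, hS, hA' g hg⟩⟩

theorem continuous_add_const_setOpenTopology {X ι : Type*} [TopologicalSpace X]
    {Λ : Set (Set X)} (hcc : ∀ A ∈ Λ, CCompactIn ι A) (f : C(X, ι → ℝ)) :
    Continuous[inferInstance, setOpenTopology ι Λ]
      (fun v : ι → ℝ => f + ContinuousMap.const X v) := by
  refine continuous_generateFrom_iff.2 ?_
  rintro _ ⟨A, hA, U, hU, rfl⟩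
  refine isOpen_iff_mem_nhds.2 fun v hv => ?_
  have hcont : Continuous (fun q : (ι → ℝ) × (ι → ℝ) => q.2 + q.1) := by fun_prop
  have h : ∀ᶠ w in 𝓝 v, ∀ y ∈ f '' A, y + w ∈ U := by
    refine (hcc A hA f).eventually_forall_of_forall_eventually ?_
    rintro _ ⟨x, hx, rfl⟩
    exact (hU.preimage hcont).mem_nhds (hv hx)
  filter_upwards [h] with w hw x hx
  exact hw _ (mem_image_of_mem _ hx)

theorem exists_subset_closure_of_mem_lambdaM {X ι : Type*} [TopologicalSpace X]
    [CompletelyRegularSpace X] [Nonempty ι] {Λ : Set (Set X)}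
    (hunion : ∀ A ∈ Λ, ∀ B ∈ Λ, A ∪ B ∈ Λ) {B : Set X} (hB : B ∈ lambdaM ι Λ) :
    ∃ A ∈ Λ, B ⊆ closure A := by
  let i := Classical.arbitrary ι
  obtain ⟨⟨b, hb⟩, hopen⟩ := hB
  have hU : IsOpen {v : ι → ℝ | v i < 1} := isOpen_lt (by fun_prop) (by fun_prop)
  obtain ⟨A, hA, hS⟩ := exists_forall_eqOn_mem hunion (hopen _ hU) (f := 0)
    (fun _ _ => by simp)
  rcases hA with rfl | hA
  · have := hS (ContinuousMap.const X fun _ => 1) (eqOn_empty _ _) hb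
    simp at this
  · refine ⟨A, hA, fun x hx => ?_⟩
    by_contra hxA
    obtain ⟨φ, hφ, hφx, hφA⟩ :=
      CompletelyRegularSpace.completely_regular x (closure A) isClosed_closure hxA
    have := hS ⟨fun y _ => 1 - (φ y : ℝ), by fun_prop⟩
      (fun y hy => by ext; simp [hφA (subset_closure hy)]) hx
    simp [hφx] at this

theorem cCompactIn_of_mem_lambdaM {X ι : Type*} [TopologicalSpace X]
    {Λ : Set (Set X)} (hcc : ∀ A ∈ Λ, CCompactIn ι A) {A B : Set X} (hA : A ∈ Λ)
    (hBA : B ⊆ closure A) (hB : B ∈ lambdaM ι Λ) : CCompactIn ι B := by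
  intro f
  refine (hcc A hA f).of_isClosed_subset (isClosed_of_closure_subset fun p hp => ?_)
    (((hcc A hA).mapsTo_closure (mapsTo_image f A)).mono_left hBA).image_subset
  by_contra hpB
  have hopen := @Continuous.isOpen_preimage _ _ _ (setOpenTopology ι Λ) _
    (continuous_add_const_setOpenTopology hcc f) _ (hB.2 {p}ᶜ isOpen_compl_singleton)
  have hN := hopen.preimage (continuous_const.sub continuous_id : Continuous fun y => p - y)
  obtain ⟨_, hy, x, hx, rfl⟩ := mem_closure_iff.1 hp _ hN (fun x hx => by
    simpa using fun h => hpB ⟨x, hx, h⟩)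
  exact hy hx (by simp)

theorem mem_lambdaM_of_subset_closure {X ι : Type*} [TopologicalSpace X] [Nonempty ι]
    {Λ : Set (Set X)} (hcc : ∀ A ∈ Λ, CCompactIn ι A)
    (hhered : ∀ A ∈ Λ, ∀ B ⊆ A, B.Nonempty → CCompactIn ι B → B ∈ Λ)
    {A B : Set X} (hne : B.Nonempty) (hB : CCompactIn ι B) (hA : A ∈ Λ)
    (hBA : B ⊆ closure A) : B ∈ lambdaM ι Λ := by
  refine ⟨hne, fun U hU => (@isOpen_iff_forall_mem_open _ (setOpenTopology ι Λ) _).2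
    fun f hf => ?_⟩
  obtain ⟨V, hV, hBV, hVU⟩ : ∃ V, IsOpen V ∧ f '' B ⊆ V ∧ closure V ⊆ U :=
    (hB f).exists_isOpen_closure_subset (hU.mem_nhdsSet.2 (mapsTo_iff_image_subset.1 hf))
  have hBA' : B ⊆ closure (A ∩ f ⁻¹' closure V) := fun b hb =>
    closure_mono (inter_subset_inter_right _ (preimage_mono subset_closure))
      ((hV.preimage f.continuous).closure_inter ⟨hBA hb, hBV (mem_image_of_mem _ hb)⟩)
  have hA'c := (hcc A hA).inter_preimage f (isClosed_closure (s := V))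
  have hA' := hhered A hA _ inter_subset_left (closure_nonempty_iff.1 (hne.mono hBA')) hA'c
  exact ⟨{g | MapsTo g (A ∩ f ⁻¹' closure V) U},
    fun g hg => (hA'c.mapsTo_closure hg).mono_left hBA',
    TopologicalSpace.isOpen_generateFrom_of_mem ⟨_, hA', U, hU, rfl⟩, fun x hx => hVU hx.2⟩

theorem statement_13 {X : Type*} [TopologicalSpace X] [T35Space X]
    (ι : Type*) [Nonempty ι] (Λ : Set (Set X))
    (hne : ∀ A ∈ Λ, A.Nonempty)
    (hcc : ∀ A ∈ Λ, CCompactIn ι A)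
    (hhered : ∀ A ∈ Λ, ∀ B ⊆ A, B.Nonempty → CCompactIn ι B → B ∈ Λ)
    (hunion : ∀ A ∈ Λ, ∀ B ∈ Λ, A ∪ B ∈ Λ)
    (hlam : Λ = lambdaC ι Λ) :
    lambdaM ι Λ =
      {B : Set X | B.Nonempty ∧ CCompactIn ι B ∧ ∃ A ∈ Λ, B ⊆ closure A} := by
  ext B
  constructor
  · intro hB
    obtain ⟨A, hA, hBA⟩ := exists_subset_closure_of_mem_lambdaM hunion hB
    exact ⟨hB.1, cCompactIn_of_mem_lambdaM hcc hA hBA hB, A, hA, hBA⟩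
  · rintro ⟨hBne, hB, A, hA, hBA⟩
    exact mem_lambdaM_of_subset_closure hcc hhered hBne hB hA hBA
end

section
/- For every nonempty index type ι, the space ℝ^ι (with the product topology) is a cub-space: for every point x ∈ ℝ^ι × ℝ^ι there exist a continuous map f : ℝ^ι × ℝ^ι → ℝ^ι and a point y ∈ ℝ^ι such that f⁻¹({y}) = {x}. -/
/-- `ℝ^ι` is a cub-space: every point of `ℝ^ι × ℝ^ι` is the exact fiber of some
continuous map `ℝ^ι × ℝ^ι → ℝ^ι` over some point. -/
theorem statement_15 (ι : Type*) [Nonempty ι] (x : (ι → ℝ) × (ι → ℝ)) :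
    ∃ f : (ι → ℝ) × (ι → ℝ) → (ι → ℝ), Continuous f ∧ ∃ y : ι → ℝ, f ⁻¹' {y} = {x} := by
  refine ⟨fun p i => (p.1 i - x.1 i) ^ 2 + (p.2 i - x.2 i) ^ 2, by fun_prop, 0, ?_⟩
  ext p
  simp only [Set.mem_preimage, Set.mem_singleton_iff]
  constructor
  · intro h
    have key (i : ι) : p.1 i = x.1 i ∧ p.2 i = x.2 i := by
      have hi : (p.1 i - x.1 i) ^ 2 + (p.2 i - x.2 i) ^ 2 = 0 := congrFun h i
      constructor <;> nlinarith [sq_nonneg (p.1 i - x.1 i), sq_nonneg (p.2 i - x.2 i)]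
    exact Prod.ext (funext fun i => (key i).1) (funext fun i => (key i).2)
  · rintro rfl
    ext i
    simp
end

section
/- If Y is a Tychonoff (completely regular Hausdorff) topological space with countable pseudocharacter (every singleton of Y is the intersection of countably many open sets) that contains a subspace homeomorphic to the closed unit interval [0,1], then Y is a cub-space: for every point x ∈ Y × Y there exist a continuous map f : Y × Y → Y and a point y ∈ Y such that f⁻¹({y}) = {x}. -/
/-- In a completely regular space, a point that is a countable intersection of open sets is the
zero set of a nonnegative continuous real function. -/
theorem CompletelyRegularSpace.exists_continuous_nonneg_eq_zero_iff {X : Type*}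
    [TopologicalSpace X] [CompletelyRegularSpace X] {x : X} {U : ℕ → Set X}
    (hU : ∀ n, IsOpen (U n)) (hx : ⋂ n, U n = {x}) :
    ∃ h : X → ℝ, Continuous h ∧ (∀ z, 0 ≤ h z) ∧ ∀ z, h z = 0 ↔ z = x := by
  have hxU : ∀ n, x ∈ U n := Set.mem_iInter.1 (hx ▸ Set.mem_singleton x)
  choose g hgc hgx hgU using fun n ↦
    CompletelyRegularSpace.completely_regular x (U n)ᶜ (hU n).isClosed_compl
      (Set.notMem_compl_iff.2 (hxU n))
  have hnonneg : ∀ z n, 0 ≤ (1 / 2 : ℝ) ^ n * g n z := fun z n ↦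
    mul_nonneg (by positivity) (g n z).2.1
  have hle : ∀ n z, (1 / 2 : ℝ) ^ n * g n z ≤ (1 / 2 : ℝ) ^ n := fun n z ↦
    mul_le_of_le_one_right (by positivity) (g n z).2.2
  have hsum : ∀ z, Summable fun n ↦ (1 / 2 : ℝ) ^ n * g n z := fun z ↦
    summable_geometric_two.of_nonneg_of_le (hnonneg z) (hle · z)
  refine ⟨fun z ↦ ∑' n, (1 / 2 : ℝ) ^ n * g n z, ?_, fun z ↦ tsum_nonneg (hnonneg z),
    fun z ↦ ⟨fun hz ↦ ?_, ?_⟩⟩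
  · refine continuous_tsum (fun n ↦ ?_) summable_geometric_two fun n z ↦ ?_
    · exact continuous_const.mul (continuous_subtype_val.comp (hgc n))
    · rw [Real.norm_of_nonneg (hnonneg z n)]
      exact hle n z
  · have hterm : ∀ n, (1 / 2 : ℝ) ^ n * g n z = 0 := fun n ↦
      congrFun ((hasSum_zero_iff_of_nonneg (hnonneg z)).1 ((hsum z).hasSum_iff.2 hz)) n
    have hmem : z ∈ ⋂ n, U n := by
      refine Set.mem_iInter.2 fun n ↦ ?_
      by_contra hn
      have hone : g n z = 1 := hgU n hn
      simpa [hone] using hterm n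
    simpa [hx] using hmem
  · rintro rfl
    simp [hgx]

/-- A Tychonoff space with countable pseudocharacter containing a copy of `[0,1]`
is a cub-space. -/
theorem statement_16 {Y : Type*} [TopologicalSpace Y] [T35Space Y]
    (hpsi : ∀ y : Y, ∃ U : ℕ → Set Y, (∀ n, IsOpen (U n)) ∧ (⋂ n, U n) = {y})
    (hI : ∃ s : Set Y, Nonempty (unitInterval ≃ₜ s)) :
    ∀ x : Y × Y, ∃ f : Y × Y → Y, Continuous f ∧ ∃ y : Y, f ⁻¹' {y} = {x} := by
  rintro ⟨a, b⟩
  obtain ⟨s, ⟨e⟩⟩ := hI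
  obtain ⟨U, hU, hUa⟩ := hpsi a
  obtain ⟨V, hV, hVb⟩ := hpsi b
  obtain ⟨h, hc, h0, hz⟩ :=
    CompletelyRegularSpace.exists_continuous_nonneg_eq_zero_iff hU hUa
  obtain ⟨k, kc, k0, kz⟩ :=
    CompletelyRegularSpace.exists_continuous_nonneg_eq_zero_iff hV hVb
  refine ⟨fun p ↦ e (Set.projIcc 0 1 zero_le_one (h p.1 + k p.2)), ?_, e 0, ?_⟩
  · exact continuous_subtype_val.comp (e.continuous.comp (continuous_projIcc.comp
      ((hc.comp continuous_fst).add (kc.comp continuous_snd))))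
  · ext ⟨u, v⟩
    rw [Set.mem_preimage, Set.mem_singleton_iff, Set.mem_singleton_iff, Subtype.coe_inj,
      e.injective.eq_iff, Prod.mk.injEq, ← hz u, ← kz v,
      ← add_eq_zero_iff_of_nonneg (h0 u) (k0 v)]
    exact (Set.projIcc_eq_left zero_lt_one).trans
      ⟨fun hle ↦ hle.antisymm (add_nonneg (h0 u) (k0 v)), fun heq ↦ heq.le⟩
end

section
/- Let α be a cardinal whose cofinality cf(α) is uncountable, and let X = [0,α) be the space of all ordinals less than the initial ordinal of α, with the order topology. Then: (a) for every infinite cardinal γ with γ < cf(α) and every index type ι of cardinality γ, every continuous map f : X → ℝ^ι has compact image (X is γ-pseudocompact); and (b) for every index type ι' of cardinality cf(α) there exists a continuous map f : X → ℝ^{ι'} whose image is not compact (X is not cf(α)-pseudocompact). -/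
universe u v

open Cardinal

theorem IsClosed.dirSupClosed {X : Type v} [LinearOrder X] [TopologicalSpace X] [OrderTopology X]
    {s : Set X} (hs : IsClosed s) : DirSupClosed s :=
  fun _ hds hd _ _ ha => closure_minimal hds hs (ha.mem_closure hd)

/-- On a well-order of uncountable cofinality, a real continuous function is eventually on one
side of any gap `(r, q)`. -/
theorem Continuous.exists_forall_ge_lt_or_forall_ge_gt {X : Type v} [LinearOrder X]
    [WellFoundedLT X] [TopologicalSpace X] [OrderTopology X] (hX : ℵ₀ < Order.cof X)
    {g : X → ℝ} (hg : Continuous g) {r q : ℝ} (hrq : r < q) :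
    ∃ b, (∀ x, b ≤ x → r < g x) ∨ ∀ x, b ≤ x → g x < q := by
  have key : ¬ (IsCofinal {x | g x ≤ r} ∧ IsCofinal {x | q ≤ g x}) := by
    rintro ⟨h₁, h₂⟩
    have h := IsClub.inter hX.ne' ⟨(isClosed_le hg continuous_const).dirSupClosed, h₁⟩
      ⟨(isClosed_le continuous_const hg).dirSupClosed, h₂⟩
    have : Nonempty X := Order.cof_ne_zero_iff.1 (aleph0_pos.trans hX).ne'
    obtain ⟨x, hx, hx'⟩ := h.nonempty
    exact (hrq.trans_le (le_trans hx' hx)).false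
  rw [not_and_or, not_isCofinal_iff, not_isCofinal_iff] at key
  rcases key with ⟨b, hb⟩ | ⟨b, hb⟩
  · exact ⟨b, .inl fun x hx => not_le.1 fun h => (hb x h).not_ge hx⟩
  · exact ⟨b, .inr fun x hx => not_le.1 fun h => (hb x h).not_ge hx⟩

/-- Fewer than cofinality many real continuous functions on a well-order of uncountable cofinality
are simultaneously eventually constant. -/
theorem Continuous.exists_forall_ge_eq {X : Type v} [LinearOrder X]
    [WellFoundedLT X] [TopologicalSpace X] [OrderTopology X] (hX : ℵ₀ < Order.cof X)
    {ι : Type u} (hι : Cardinal.lift.{v} #ι < Cardinal.lift.{u} (Order.cof X))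
    {f : X → ι → ℝ} (hf : Continuous f) : ∃ b, ∀ x, b ≤ x → f x = f b := by
  have H (p : ι × {p : ℚ × ℚ // p.1 < p.2}) :=
    ((continuous_apply p.1).comp hf).exists_forall_ge_lt_or_forall_ge_gt hX
      (Rat.cast_lt.2 p.2.2)
  choose b hb using H
  have hcard : Cardinal.lift.{u} #(Set.range b) < Cardinal.lift.{u} (Order.cof X) := by
    refine mk_range_le_lift.trans_lt ?_
    rw [mk_prod, Cardinal.lift_mul, Cardinal.lift_lift, Cardinal.lift_lift]
    refine mul_lt_of_lt (by simpa using hX.le) (by simpa using hι) ?_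
    refine lt_of_le_of_lt (b := ℵ₀) ?_ (by simpa using hX)
    simp
  have hbdd : BddAbove (Set.range b) :=
    .of_not_isCofinal fun h => (Order.cof_le h).not_gt (Cardinal.lift_lt.1 hcard)
  obtain ⟨c, hc⟩ := hbdd
  have hlt : ∀ x y, c ≤ x → c ≤ y → ∀ i, ¬ f x i < f y i := by
    intro x y hx hy i hxy
    obtain ⟨r, hr, hr'⟩ := exists_rat_btwn hxy
    obtain ⟨q, hq, hq'⟩ := exists_rat_btwn hr'
    have hcb := hc ⟨(i, ⟨(r, q), Rat.cast_lt.1 hq⟩), rfl⟩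
    rcases hb (i, ⟨(r, q), Rat.cast_lt.1 hq⟩) with h | h
    · exact (h x (hcb.trans hx)).asymm hr
    · exact (h y (hcb.trans hy)).asymm hq'
  exact ⟨c, fun x hx => funext fun i =>
    le_antisymm (not_lt.1 (hlt c x le_rfl hx i)) (not_lt.1 (hlt x c hx le_rfl i))⟩

theorem WellFoundedLT.isCompact_Iic {X : Type v} [LinearOrder X] [WellFoundedLT X]
    [TopologicalSpace X] [OrderTopology X] (b : X) : IsCompact (Set.Iic b) := by
  have : Nonempty X := ⟨b⟩
  let _ := WellFoundedLT.toOrderBot X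
  let _ := WellFoundedLT.conditionallyCompleteLinearOrderBot X
  rw [← Set.Icc_bot]
  exact isCompact_Icc

theorem Continuous.isCompact_range_of_lt_cof {X : Type v} [LinearOrder X]
    [WellFoundedLT X] [TopologicalSpace X] [OrderTopology X] (hX : ℵ₀ < Order.cof X)
    {ι : Type u} (hι : Cardinal.lift.{v} #ι < Cardinal.lift.{u} (Order.cof X))
    {f : X → ι → ℝ} (hf : Continuous f) : IsCompact (Set.range f) := by
  obtain ⟨b, hb⟩ := hf.exists_forall_ge_eq hX hι
  have : Set.range f = f '' Set.Iic b := by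
    refine (Set.range_subset_iff.2 fun x => ?_).antisymm (Set.image_subset_range _ _)
    rcases le_total x b with h | h
    · exact ⟨x, h, rfl⟩
    · exact ⟨b, le_rfl, (hb x h).symm⟩
  rw [this]
  exact (WellFoundedLT.isCompact_Iic b).image hf

theorem WellFoundedLT.isClopen_Iic {X : Type v} [LinearOrder X] [WellFoundedLT X] [NoMaxOrder X]
    [TopologicalSpace X] [OrderTopology X] (b : X) : IsClopen (Set.Iic b) := by
  let _ : SuccOrder X := SuccOrder.ofLinearWellFoundedLT X
  refine ⟨isClosed_Iic, ?_⟩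
  rw [← Order.Iio_succ]
  exact isOpen_Iio

/-- A cofinal family in a well-order without maximum yields a continuous map with noncompact
image. -/
theorem IsCofinal.exists_continuous_not_isCompact_range {X : Type v} [LinearOrder X]
    [WellFoundedLT X] [NoMaxOrder X] [Nonempty X] [TopologicalSpace X] [OrderTopology X]
    {ι : Type u} {e : ι → X} (he : IsCofinal (Set.range e)) :
    ∃ f : X → ι → ℝ, Continuous f ∧ ¬ IsCompact (Set.range f) := by
  refine ⟨fun x i => (Set.Ioi (e i)).indicator 1 x, ?_, fun h => ?_⟩
  · refine continuous_pi fun i => continuous_one.indicator fun x hx => ?_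
    have : IsClopen (Set.Ioi (e i)) := by
      simpa using (WellFoundedLT.isClopen_Iic (e i)).compl
    simp [this.frontier_eq] at hx
  · have hlim : Filter.Tendsto (fun x i => (Set.Ioi (e i)).indicator (1 : X → ℝ) x)
        Filter.atTop (nhds 1) := by
      refine tendsto_pi_nhds.2 fun i => tendsto_const_nhds.congr' ?_
      filter_upwards [Filter.eventually_gt_atTop (e i)] with x hx
      simp [hx]
    obtain ⟨x, hx⟩ := h.isClosed.mem_of_tendsto hlim (.of_forall fun x => ⟨x, rfl⟩)
    obtain ⟨_, ⟨i, rfl⟩, hi⟩ := he x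
    simpa [hi] using congrFun hx i

/-- For a cardinal `α` of uncountable cofinality, the ordinal space `X = [0, α)`
(with the order topology) is `γ`-pseudocompact for every infinite `γ < cf(α)`,
and is not `cf(α)`-pseudocompact. -/
theorem statement_17 (α : Cardinal.{u}) (hcof : Cardinal.aleph0 < (Cardinal.ord α).cof) :
    (∀ γ : Cardinal.{u}, Cardinal.aleph0 ≤ γ → γ < (Cardinal.ord α).cof →
      ∀ ι : Type u, Cardinal.mk ι = γ →
        ∀ f : {o : Ordinal.{u} // o < Cardinal.ord α} → (ι → ℝ),
          Continuous f → IsCompact (Set.range f)) ∧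
    (∀ ι' : Type u, Cardinal.mk ι' = (Cardinal.ord α).cof →
      ∃ f : {o : Ordinal.{u} // o < Cardinal.ord α} → (ι' → ℝ),
        Continuous f ∧ ¬ IsCompact (Set.range f)) := by
  have hX : Order.cof (Set.Iio α.ord) = Cardinal.lift.{u + 1} α.ord.cof := by
    rw [Ordinal.cof_Iio, Ordinal.lift_cof]
  have hX' : ℵ₀ < Order.cof (Set.Iio α.ord) := by simpa only [hX, aleph0_lt_lift] using hcof
  have : OrderTopology (Set.Iio α.ord) := orderTopology_of_ordConnected
  constructor
  · rintro γ - hγ ι rfl f hf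
    refine Continuous.isCompact_range_of_lt_cof (X := Set.Iio α.ord) hX' ?_ hf
    rw [hX, Cardinal.lift_lift]
    exact Cardinal.lift_lt.2 hγ
  · intro ι hι
    have : Nonempty (Set.Iio α.ord) := Order.cof_ne_zero_iff.1 (aleph0_pos.trans hX').ne'
    have : NoTopOrder (Set.Iio α.ord) := Order.one_lt_cof_iff.1 (one_lt_aleph0.trans hX')
    have : NoMaxOrder (Set.Iio α.ord) := NoTopOrder.to_noMaxOrder _
    obtain ⟨s, hs, hsc⟩ := Order.exists_cof_eq (Set.Iio α.ord)
    rw [hX, ← hι] at hsc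
    obtain ⟨e⟩ := Cardinal.lift_mk_eq'.1
      ((Cardinal.lift_id'.{u, u + 1} #s).trans hsc).symm
    have he : IsCofinal (Set.range fun i => (e i : Set.Iio α.ord)) := by
      simpa [← Function.comp_def Subtype.val e, Set.range_comp] using hs
    exact he.exists_continuous_not_isCompact_range
end

section
/- Let X = [0,ω₁) be the space of all countable ordinals with the order topology, and let λ be the family of all nonempty C-compact subsets of X (subsets B such that f(B) is compact for every continuous real-valued f on X). Then the λ-open topology makes C(X,ℝ^ℕ) a topological group under pointwise addition (indeed a locally convex topological vector space and a topological algebra over ℝ), while for any index type ι of cardinality ℵ₁ the λ-open topology on C(X,ℝ^ι) does not make addition separately continuous (it is not a semitopological group). -/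
open Topology Set

/-- A subset `B ⊆ X` is `C`-compact in `X` if `f(B)` is compact in `ℝ` for every
continuous real-valued `f` on `X`. -/
def CCompactReal {X : Type*} [TopologicalSpace X] (B : Set X) : Prop :=
  ∀ f : C(X, ℝ), IsCompact (⇑f '' B)

open BoundedContinuousFunction Filter

section SetOpen

variable {X : Type*} [TopologicalSpace X]

theorem isOpen_setOf_mapsTo {ι : Type*} {Λ : Set (Set X)} {A : Set X} (hA : A ∈ Λ)
    {U : Set (ι → ℝ)} (hU : IsOpen U) :
    IsOpen[setOpenTopology ι Λ] {f : C(X, ι → ℝ) | Set.MapsTo f A U} :=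
  TopologicalSpace.isOpen_generateFrom_of_mem ⟨A, hA, U, hU, rfl⟩

/-- A `C`-compact set has compact image under every continuous map into a countable power of `ℝ`. -/
theorem CCompactReal.cCompactIn {ι : Type*} [Countable ι] {B : Set X} (hB : CCompactReal B) :
    CCompactIn ι B := by
  intro f
  have hcoord (i : ι) : IsCompact ((fun x => f x i) '' B) :=
    hB ⟨fun x => f x i, by fun_prop⟩
  refine (isCompact_univ_pi hcoord).of_isClosed_subset ?_ ?_
  · refine isClosed_of_closure_subset fun p hp => ?_
    let := TopologicalSpace.pseudoMetrizableSpacePseudoMetric (ι → ℝ)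
    let h : C(X, ℝ) := ⟨fun x => dist (f x) p, by fun_prop⟩
    have h0 : (0 : ℝ) ∈ h '' B := by
      rw [← (hB h).isClosed.closure_eq]
      have := image_closure_subset_closure_image (s := f '' B)
        (f := fun y : ι → ℝ => dist y p) (by fun_prop) ⟨p, hp, dist_self p⟩
      rwa [image_image] at this
    obtain ⟨x, hx, hxp⟩ := h0
    exact ⟨x, hx, (Metric.inseparable_iff.2 hxp).eq⟩
  · rintro _ ⟨x, hx, rfl⟩ i -
    exact ⟨x, hx, rfl⟩

theorem CCompactReal.exists_norm_le (hX : CCompactReal (univ : Set X)) (f : C(X, ℝ)) :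
    ∃ C, ∀ x, ‖f x‖ ≤ C := by
  obtain ⟨C, hC⟩ := (hX f).isBounded.exists_norm_le
  exact ⟨C, fun x => hC _ ⟨x, mem_univ x, rfl⟩⟩

/-- On a pseudocompact space, a continuous map into `ℝ^ι` as a family of bounded continuous
functions. -/
noncomputable def coordBCF (ι : Type*) (hX : CCompactReal (univ : Set X)) :
    C(X, ι → ℝ) →ₗ[ℝ] ι → X →ᵇ ℝ where
  toFun f i := BoundedContinuousFunction.ofNormedAddCommGroup (fun x => f x i) (by fun_prop)
    (hX.exists_norm_le ⟨fun x => f x i, by fun_prop⟩).choose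
    (hX.exists_norm_le ⟨fun x => f x i, by fun_prop⟩).choose_spec
  map_add' _ _ := rfl
  map_smul' _ _ := rfl

theorem tendstoUniformly_nhds_induced_coordBCF {ι : Type*} (hX : CCompactReal (univ : Set X))
    (f : C(X, ι → ℝ)) :
    TendstoUniformly (fun (g : C(X, ι → ℝ)) x => g x) f
      (@nhds _ (TopologicalSpace.induced (coordBCF ι hX) inferInstance) f) := by
  rw [nhds_induced, tendstoUniformly_iff_tendsto, Pi.uniformity, tendsto_iInf]
  intro i
  rw [tendsto_comap_iff]
  have h : Tendsto (fun g : C(X, ι → ℝ) => coordBCF ι hX g i)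
      (comap (coordBCF ι hX) (𝓝 (coordBCF ι hX f))) (𝓝 (coordBCF ι hX f i)) :=
    ((continuous_apply i).tendsto _).comp tendsto_comap
  exact tendstoUniformly_iff_tendsto.1
    (BoundedContinuousFunction.tendsto_iff_tendstoUniformly.1 h)

theorem induced_coordBCF_le_setOpenTopology {ι : Type*} [Countable ι]
    (hX : CCompactReal (univ : Set X)) {Λ : Set (Set X)} (hΛ : ∀ A ∈ Λ, CCompactReal A) :
    TopologicalSpace.induced (coordBCF ι hX) inferInstance ≤ setOpenTopology ι Λ := by
  refine le_generateFrom ?_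
  rintro _ ⟨A, hA, U, hU, rfl⟩
  let : TopologicalSpace C(X, ι → ℝ) :=
    TopologicalSpace.induced (coordBCF ι hX) inferInstance
  refine isOpen_iff_mem_nhds.2 fun f hf => ?_
  obtain ⟨V, hV, -, hVU⟩ := lebesgue_number_of_compact_open ((hΛ A hA).cCompactIn f) hU
    (mapsTo_iff_image_subset.1 hf)
  filter_upwards [tendstoUniformly_nhds_induced_coordBCF hX f V hV] with g hg x hx
  exact hVU _ ⟨x, hx, rfl⟩ (hg x)

theorem setOpenTopology_le_induced_coordBCF {ι : Type*} (hX : CCompactReal (univ : Set X))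
    {Λ : Set (Set X)} (hΛ : ∀ A : Set X, IsClosed A → A.Nonempty → A ∈ Λ) :
    setOpenTopology ι Λ ≤ TopologicalSpace.induced (coordBCF ι hX) inferInstance := by
  rw [← continuous_iff_le_induced]
  let := setOpenTopology ι Λ
  refine continuous_pi fun i => continuous_iff_continuousAt.2 fun f => ?_
  refine BoundedContinuousFunction.tendsto_iff_tendstoUniformly.2 ?_
  refine Metric.tendstoUniformly_iff.2 fun ε hε => ?_
  have hc : Continuous fun x => f x i := by fun_prop
  obtain ⟨t, ht, htf, hcov⟩ := (hX ⟨_, hc⟩).finite_cover_balls (half_pos (half_pos hε))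
  have hev : ∀ c ∈ t, ∀ᶠ g : C(X, ι → ℝ) in 𝓝 f, MapsTo g ((fun x => f x i) ⁻¹' Metric.closedBall c (ε / 2 / 2))
      ((fun y : ι → ℝ => y i) ⁻¹' Metric.ball c (ε / 2)) := by
    intro c hct
    obtain ⟨x, -, hx⟩ := ht hct
    refine (isOpen_setOf_mapsTo (hΛ _ (Metric.isClosed_closedBall.preimage hc) ⟨x, ?_⟩)
      (Metric.isOpen_ball.preimage (continuous_apply i))).mem_nhds fun y hy => ?_
    · simpa [← hx] using (half_pos (half_pos hε)).le
    · exact Metric.closedBall_subset_ball (half_lt_self (half_pos hε)) hy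
  filter_upwards [(eventually_all_finite htf).2 hev] with g hg x
  obtain ⟨c, hct, hxc⟩ := mem_iUnion₂.1 (hcov ⟨x, mem_univ x, rfl⟩)
  have h1 : dist (g x i) c < ε / 2 := hg c hct (Metric.ball_subset_closedBall hxc)
  have h2 : dist (f x i) c < ε / 2 / 2 := hxc
  have h3 := dist_triangle_right (f x i) (g x i) c
  change dist (f x i) (g x i) < ε
  linarith

/-- If every closed subset is `C`-compact, then the set-open topology on the nonempty `C`-compact
sets is the topology of uniform convergence of each coordinate. -/
theorem setOpenTopology_eq_induced_coordBCF {ι : Type*} [Countable ι]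
    (hX : ∀ A : Set X, IsClosed A → CCompactReal A) :
    setOpenTopology ι {B : Set X | B.Nonempty ∧ CCompactReal B} =
      TopologicalSpace.induced (coordBCF ι (hX univ isClosed_univ)) inferInstance :=
  le_antisymm (setOpenTopology_le_induced_coordBCF _ fun A hA hne => ⟨hne, hX A hA⟩)
    (induced_coordBCF_le_setOpenTopology _ fun _ hA => hA.2)

theorem continuous_const_setOpenTopology {ι : Type*} {Λ : Set (Set X)}
    (hΛ : ∀ A ∈ Λ, A.Nonempty) :
    Continuous[inferInstance, setOpenTopology ι Λ] (ContinuousMap.const X : (ι → ℝ) → _) := by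
  refine continuous_generateFrom_iff.2 ?_
  rintro _ ⟨A, hA, U, hU, rfl⟩
  obtain ⟨a, ha⟩ := hΛ A hA
  convert hU using 1
  ext y
  exact ⟨fun h => h ha, fun h _ _ => h⟩

end SetOpen

section CountableOrdinals

/-- The space `[0, ω₁)` of countable ordinals. -/
abbrev CountableOrdinal : Type 1 := {o : Ordinal.{0} // o < (Cardinal.aleph 1).ord}

theorem exists_forall_le_of_nat (a : ℕ → CountableOrdinal) :
    ∃ b : CountableOrdinal, ∀ n, a n ≤ b := by
  refine ⟨⟨⨆ n, (a n : Ordinal), ?_⟩, fun n => Ordinal.le_iSup (fun n => (a n : Ordinal)) n⟩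
  have := Ordinal.iSup_lt_omega_one (f := fun n => (a n : Ordinal))
    fun n => by simpa using (a n).2
  simpa using this

theorem isCompact_Iic_countableOrdinal (b : CountableOrdinal) : IsCompact (Iic b) := by
  rw [Subtype.isCompact_iff]
  convert isCompact_Icc (a := (0 : Ordinal.{0})) (b := b)
  ext o
  constructor
  · rintro ⟨x, hx, rfl⟩
    exact ⟨zero_le, hx⟩
  · rintro ⟨-, ho⟩
    exact ⟨⟨o, ho.trans_lt b.2⟩, ho, rfl⟩

theorem cCompactReal_of_isClosed_countableOrdinal (A : Set CountableOrdinal) (hA : IsClosed A) :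
    CCompactReal A := by
  intro f
  rw [isCompact_iff_isSeqCompact]
  intro y hy
  choose a haA hay using hy
  obtain ⟨b, hb⟩ := exists_forall_le_of_nat a
  have hK : IsCompact (f '' (Iic b ∩ A)) :=
    ((isCompact_Iic_countableOrdinal b).inter_right hA).image f.continuous
  obtain ⟨z, hz, φ, hφ, hlim⟩ := hK.isSeqCompact (x := y) fun n => ⟨a n, ⟨hb n, haA n⟩, hay n⟩
  exact ⟨z, image_mono inter_subset_right hz, φ, hφ, hlim⟩

theorem isClopen_Ioi_countableOrdinal (b : CountableOrdinal) : IsClopen (Ioi b) := by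
  constructor
  · have : Ioi b = Subtype.val ⁻¹' Ici (Order.succ (b : Ordinal)) := by
      ext x
      exact (Order.succ_le_iff (a := (b : Ordinal)) (b := x)).symm
    rw [this]
    exact isClosed_Ici.preimage continuous_subtype_val
  · exact isOpen_Ioi.preimage continuous_subtype_val

theorem nonempty_equiv_countableOrdinal {ι : Type} (hι : Cardinal.mk ι = Cardinal.aleph 1) :
    Nonempty (ι ≃ CountableOrdinal) := by
  rw [← Cardinal.lift_mk_eq', hι]
  have := Cardinal.mk_Iio_ordinal (Cardinal.aleph 1).ord
  rw [Cardinal.card_ord] at this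
  rw [Cardinal.lift_id'.{0, 1}]
  exact this.symm

theorem not_continuous_add_setOpenTopology_countableOrdinal {ι : Type} (e : ι ≃ CountableOrdinal)
    {Λ : Set (Set CountableOrdinal)} (hΛ : ∀ A ∈ Λ, A.Nonempty) (huniv : univ ∈ Λ) :
    ∃ g : C(CountableOrdinal, ι → ℝ),
      ¬ Continuous[setOpenTopology ι Λ, setOpenTopology ι Λ] (fun f => f + g) := by
  let g : C(CountableOrdinal, ι → ℝ) := ⟨fun x i => (Ioi (e i)).indicator 1 x,
    continuous_pi fun i => (isClopen_Ioi_countableOrdinal (e i)).continuous_indicator continuous_one⟩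
  refine ⟨g, fun hg => ?_⟩
  have hopen := continuous_def.1 (continuous_const_setOpenTopology hΛ) _
    (continuous_def.1 hg _ (isOpen_setOf_mapsTo huniv
      (isOpen_compl_singleton (x := (1 : ι → ℝ)))))
  obtain ⟨a, -⟩ := hΛ _ huniv
  have : Nonempty CountableOrdinal := ⟨a⟩
  have hlim : Tendsto (fun x => 1 - g x) atTop (𝓝 0) := by
    refine tendsto_pi_nhds.2 fun i => ?_
    have hmem : ∀ᶠ x in atTop, x ∈ Ioi (e i) := by
      have hsucc : Order.IsSuccLimit (Cardinal.aleph 1).ord :=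
        Cardinal.isSuccLimit_ord (Cardinal.aleph0_le_aleph 1)
      filter_upwards [eventually_ge_atTop (⟨_, hsucc.succ_lt (e i).2⟩ : CountableOrdinal)] with x hx
      exact Order.succ_le_iff.1 (show Order.succ ((e i : CountableOrdinal) : Ordinal) ≤ x from hx)
    refine tendsto_const_nhds.congr' ?_
    filter_upwards [hmem] with x hx
    change (0 : ℝ) = 1 - (Ioi (e i)).indicator 1 x
    rw [indicator_of_mem hx]
    simp
  have h0 : (0 : ι → ℝ) ∈ ContinuousMap.const CountableOrdinal ⁻¹'
      ((fun f => f + g) ⁻¹' {f : C(CountableOrdinal, ι → ℝ) | MapsTo f univ {(1 : ι → ℝ)}ᶜ}) := by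
    intro x _ hx
    have := congr_fun hx (e.symm x)
    simp [g] at this
  obtain ⟨x, hx⟩ := (hlim.eventually (hopen.mem_nhds h0)).exists
  exact hx (mem_univ x) (sub_add_cancel _ _)

end CountableOrdinals

/-- For `X = [0, ω₁)` and `λ` the family of all nonempty `C`-compact subsets of `X`:
the `λ`-open topology makes `C(X, ℝ^ℕ)` a topological group, indeed a locally convex
topological vector space and a topological algebra over `ℝ`, while for any index type
of cardinality `ℵ₁` the corresponding `λ`-open topology is not a semitopological group. -/
theorem statement_19 (ι : Type) (hι : Cardinal.mk ι = Cardinal.aleph 1) :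
    ∀ Λ : Set (Set {o : Ordinal.{0} // o < (Cardinal.aleph 1).ord}),
      Λ = {B | B.Nonempty ∧ CCompactReal B} →
      (Continuous[@instTopologicalSpaceProd _ _ (setOpenTopology ℕ Λ) (setOpenTopology ℕ Λ),
          setOpenTopology ℕ Λ]
          (fun p : C({o : Ordinal.{0} // o < (Cardinal.aleph 1).ord}, ℕ → ℝ) ×
              C({o : Ordinal.{0} // o < (Cardinal.aleph 1).ord}, ℕ → ℝ) => p.1 + p.2) ∧
        Continuous[setOpenTopology ℕ Λ, setOpenTopology ℕ Λ]
          (fun f : C({o : Ordinal.{0} // o < (Cardinal.aleph 1).ord}, ℕ → ℝ) => -f) ∧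
        Continuous[@instTopologicalSpaceProd _ _ inferInstance (setOpenTopology ℕ Λ),
          setOpenTopology ℕ Λ]
          (fun p : ℝ × C({o : Ordinal.{0} // o < (Cardinal.aleph 1).ord}, ℕ → ℝ) =>
            p.1 • p.2) ∧
        (∀ S ∈ @nhds _ (setOpenTopology ℕ Λ)
            (0 : C({o : Ordinal.{0} // o < (Cardinal.aleph 1).ord}, ℕ → ℝ)),
          ∃ T ∈ @nhds _ (setOpenTopology ℕ Λ)
            (0 : C({o : Ordinal.{0} // o < (Cardinal.aleph 1).ord}, ℕ → ℝ)),
            Convex ℝ T ∧ T ⊆ S) ∧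
        Continuous[@instTopologicalSpaceProd _ _ (setOpenTopology ℕ Λ) (setOpenTopology ℕ Λ),
          setOpenTopology ℕ Λ]
          (fun p : C({o : Ordinal.{0} // o < (Cardinal.aleph 1).ord}, ℕ → ℝ) ×
              C({o : Ordinal.{0} // o < (Cardinal.aleph 1).ord}, ℕ → ℝ) => p.1 * p.2)) ∧
      ¬ (∀ g : C({o : Ordinal.{0} // o < (Cardinal.aleph 1).ord}, ι → ℝ),
          Continuous[setOpenTopology ι Λ, setOpenTopology ι Λ] (fun f => f + g) ∧
          Continuous[setOpenTopology ι Λ, setOpenTopology ι Λ] (fun f => g + f)) := by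
  rintro Λ rfl
  have hcl := cCompactReal_of_isClosed_countableOrdinal
  constructor
  · rw [setOpenTopology_eq_induced_coordBCF hcl]
    set Φ := coordBCF ℕ (hcl univ isClosed_univ)
    let : TopologicalSpace C({o : Ordinal.{0} // o < (Cardinal.aleph 1).ord}, ℕ → ℝ) :=
      TopologicalSpace.induced Φ inferInstance
    have hc : Continuous Φ := continuous_induced_dom
    refine ⟨continuous_induced_rng.2 ?_, continuous_induced_rng.2 ?_,
      continuous_induced_rng.2 ?_, ?_, continuous_induced_rng.2 ?_⟩
    · exact (hc.comp continuous_fst).add (hc.comp continuous_snd)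
    · exact hc.neg
    · exact continuous_fst.smul (hc.comp continuous_snd)
    · have hlc := LocallyConvexSpace.induced (𝕜 := ℝ) Φ
      have := topologicalAddGroup_induced Φ
      intro S hS
      obtain ⟨T, hT, hTc, hTS⟩ := (locallyConvexSpace_iff_exists_convex_subset_zero ℝ _).1 hlc S hS
      exact ⟨T, hT, hTc, hTS⟩
    · exact (hc.comp continuous_fst).mul (hc.comp continuous_snd)
  · obtain ⟨e⟩ := nonempty_equiv_countableOrdinal hι
    have hpos : (0 : Ordinal) < (Cardinal.aleph 1).ord := by
      simp [Ordinal.omega_pos]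
    obtain ⟨g, hg⟩ := not_continuous_add_setOpenTopology_countableOrdinal e
      (Λ := {B | B.Nonempty ∧ CCompactReal B}) (fun _ hA => hA.1)
      ⟨⟨⟨0, hpos⟩, mem_univ _⟩, hcl univ isClosed_univ⟩
    exact fun h => hg (h g).1
end
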